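/- Let M and N be metric spaces, let P be a Borel probability measure on M × N, and assume there exists (p₀, q₀) ∈ M × N such that z ↦ d_M(p₀, z.1) and z ↦ d_N(q₀, z.2) are integrable with respect to P. Let 0 < a ≤ b < 2 and define F_α(m) = ∫ d_α(m, z) dP(z). Then the infimum of F_α(m) over all m ∈ M × N and α ∈ [a, b] equals the minimum of inf_{m} F_a(m) and inf_{m} F_b(m). -/

import Mathlib

open MeasureTheory

/-- The scaled product distance
`d_α((p,q),(x,y)) = √(α·d_M(p,x)² + (2−α)·d_N(q,y)²)`. -/
noncomputable def dAlpha {M N : Type*} [MetricSpace M] [MetricSpace N]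
    (α : ℝ) (m z : M × N) : ℝ :=
  Real.sqrt (α * dist m.1 z.1 ^ 2 + (2 - α) * dist m.2 z.2 ^ 2)

section dAlpha

variable {M N : Type*} [MetricSpace M] [MetricSpace N]

theorem dAlpha_nonneg (α : ℝ) (m z : M × N) : 0 ≤ dAlpha α m z :=
  Real.sqrt_nonneg _

theorem dAlpha_le {α : ℝ} (h₀ : 0 ≤ α) (h₂ : α ≤ 2) (m z : M × N) :
    dAlpha α m z ≤ 2 * (dist m.1 z.1 + dist m.2 z.2) := by
  have hx : 0 ≤ dist m.1 z.1 := dist_nonneg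
  have hy : 0 ≤ dist m.2 z.2 := dist_nonneg
  refine Real.sqrt_le_iff.2 ⟨by positivity, ?_⟩
  nlinarith [mul_nonneg hx hy, mul_nonneg h₀ (sq_nonneg (dist m.2 z.2)),
    mul_nonneg (sub_nonneg.2 h₂) (sq_nonneg (dist m.1 z.1))]

theorem concaveOn_dAlpha (m z : M × N) :
    ConcaveOn ℝ (Set.Icc 0 2) (fun α => dAlpha α m z) := by
  refine ⟨convex_Icc _ _, fun α hα β hβ s t hs ht hst => ?_⟩
  have hnonneg : ∀ γ ∈ Set.Icc (0 : ℝ) 2,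
      0 ≤ γ * dist m.1 z.1 ^ 2 + (2 - γ) * dist m.2 z.2 ^ 2 := fun γ hγ =>
    add_nonneg (mul_nonneg hγ.1 (sq_nonneg _)) (mul_nonneg (sub_nonneg.2 hγ.2) (sq_nonneg _))
  refine (Real.strictConcaveOn_sqrt.concaveOn.2 (hnonneg α hα) (hnonneg β hβ) hs ht hst).trans_eq ?_
  simp only [dAlpha, smul_eq_mul]
  congr 1
  linear_combination 2 * dist m.2 z.2 ^ 2 * hst

variable [MeasurableSpace M] [MeasurableSpace N] [BorelSpace M] [BorelSpace N]

theorem measurable_dAlpha (α : ℝ) (m : M × N) : Measurable (dAlpha α m) := by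
  have h₁ : Measurable fun z : M × N => dist m.1 z.1 :=
    (continuous_const.dist continuous_id).measurable.comp measurable_fst
  have h₂ : Measurable fun z : M × N => dist m.2 z.2 :=
    (continuous_const.dist continuous_id).measurable.comp measurable_snd
  exact (((h₁.pow_const 2).const_mul α).add ((h₂.pow_const 2).const_mul (2 - α))).sqrt

theorem integrable_dAlpha {P : Measure (M × N)} [IsFiniteMeasure P] {p₀ : M} {q₀ : N}
    (hM : Integrable (fun z : M × N => dist p₀ z.1) P)
    (hN : Integrable (fun z : M × N => dist q₀ z.2) P)
    {α : ℝ} (h₀ : 0 ≤ α) (h₂ : α ≤ 2) (m : M × N) : Integrable (dAlpha α m) P := by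
  refine ((((integrable_const (dist m.1 p₀)).add hM).add
    ((integrable_const (dist m.2 q₀)).add hN)).const_mul 2).mono'
    (measurable_dAlpha α m).aestronglyMeasurable (ae_of_all _ fun z => ?_)
  rw [Real.norm_of_nonneg (dAlpha_nonneg α m z)]
  refine (dAlpha_le h₀ h₂ m z).trans ?_
  simp only [Pi.add_apply]
  linarith [dist_triangle m.1 p₀ z.1, dist_triangle m.2 q₀ z.2]

theorem concaveOn_integral_dAlpha {P : Measure (M × N)} [IsFiniteMeasure P] {p₀ : M} {q₀ : N}
    (hM : Integrable (fun z : M × N => dist p₀ z.1) P)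
    (hN : Integrable (fun z : M × N => dist q₀ z.2) P) (m : M × N) :
    ConcaveOn ℝ (Set.Icc 0 2) (fun α => ∫ z, dAlpha α m z ∂P) := by
  refine ⟨convex_Icc _ _, fun α hα β hβ s t hs ht hst => ?_⟩
  have hint : ∀ γ ∈ Set.Icc (0 : ℝ) 2, Integrable (dAlpha γ m) P := fun γ hγ =>
    integrable_dAlpha hM hN hγ.1 hγ.2 m
  have hmem := convex_Icc (0 : ℝ) 2 hα hβ hs ht hst
  simp only [smul_eq_mul] at hmem ⊢
  rw [← integral_const_mul, ← integral_const_mul,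
    ← integral_add ((hint α hα).const_mul s) ((hint β hβ).const_mul t)]
  exact integral_mono (((hint α hα).const_mul s).add ((hint β hβ).const_mul t)) (hint _ hmem)
    fun z => (concaveOn_dAlpha m z).2 hα hβ hs ht hst

end dAlpha

theorem stmt_5 {M N : Type*} [MetricSpace M] [MetricSpace N]
    [MeasurableSpace M] [MeasurableSpace N] [BorelSpace M] [BorelSpace N]
    (P : Measure (M × N)) [IsProbabilityMeasure P]
    (p₀ : M) (q₀ : N)
    (hM : Integrable (fun z : M × N => dist p₀ z.1) P)
    (hN : Integrable (fun z : M × N => dist q₀ z.2) P)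
    (a b : ℝ) (ha : 0 < a) (hab : a ≤ b) (hb : b < 2)
    (F : ℝ → M × N → ℝ)
    (hF : ∀ α m, F α m = ∫ z, dAlpha α m z ∂P) :
    sInf {v : ℝ | ∃ m : M × N, ∃ α ∈ Set.Icc a b, v = F α m} =
      min (sInf {v : ℝ | ∃ m : M × N, v = F a m})
          (sInf {v : ℝ | ∃ m : M × N, v = F b m}) := by
  have hnonneg : ∀ α m, 0 ≤ F α m := fun α m => by
    rw [hF]
    exact integral_nonneg fun z => dAlpha_nonneg α m z
  have hbdd : ∀ α, BddBelow {v : ℝ | ∃ m : M × N, v = F α m} := fun α =>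
    ⟨0, by rintro v ⟨m, rfl⟩; exact hnonneg α m⟩
  have hbdd' : BddBelow {v : ℝ | ∃ m : M × N, ∃ α ∈ Set.Icc a b, v = F α m} :=
    ⟨0, by rintro v ⟨m, α, -, rfl⟩; exact hnonneg α m⟩
  apply le_antisymm
  · refine le_min (csInf_le_csInf hbdd' ⟨_, (p₀, q₀), rfl⟩ ?_)
      (csInf_le_csInf hbdd' ⟨_, (p₀, q₀), rfl⟩ ?_)
    · rintro v ⟨m, rfl⟩
      exact ⟨m, a, Set.left_mem_Icc.2 hab, rfl⟩
    · rintro v ⟨m, rfl⟩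
      exact ⟨m, b, Set.right_mem_Icc.2 hab, rfl⟩
  · refine le_csInf ⟨_, (p₀, q₀), a, Set.left_mem_Icc.2 hab, rfl⟩ ?_
    rintro v ⟨m, α, hα, rfl⟩
    have hmin : min (F a m) (F b m) ≤ F α m := by
      simp only [hF]
      exact (concaveOn_integral_dAlpha hM hN m).min_le_of_mem_Icc
        ⟨ha.le, hab.trans hb.le⟩ ⟨ha.le.trans hab, hb.le⟩ hα
    exact (min_le_min (csInf_le (hbdd a) ⟨m, rfl⟩) (csInf_le (hbdd b) ⟨m, rfl⟩)).trans hmin
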